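/- A subset U of (F_B(ℝ^m)^p, d_p) is totally bounded if and only if U is bounded in d_p and p-mean equi-left-continuous. Consequently, in (F_B(ℝ^m)^p, d_p) a set is totally bounded if and only if it is relatively compact. -/

import Mathlib

open Metric Set MeasureTheory Filter

noncomputable section

/-- `Em m` is the Euclidean space ℝ^m. -/
abbrev Em (m : ℕ) := EuclideanSpace ℝ (Fin m)

/-- A set is star-shaped if it contains a point `x` such that the segment from `x`
to any point of the set lies in the set. -/
def StarShaped {m : ℕ} (K : Set (Em m)) : Prop :=
  ∃ x ∈ K, ∀ y ∈ K, segment ℝ x y ⊆ K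

/-- The kernel of a set: all points seeing the whole set. -/
def kern {m : ℕ} (K : Set (Em m)) : Set (Em m) :=
  {x | x ∈ K ∧ ∀ y ∈ K, segment ℝ x y ⊆ K}

/-- Kuratowski upper limit of a sequence of sets. -/
def KLimsup {m : ℕ} (C : ℕ → Set (Em m)) : Set (Em m) :=
  ⋂ n : ℕ, closure (⋃ k : ℕ, ⋃ _ : n ≤ k, C k)

/-- Kuratowski lower limit of a sequence of sets. -/
def KLiminf {m : ℕ} (C : ℕ → Set (Em m)) : Set (Em m) :=
  {x | ∃ f : ℕ → Em m, (∀ n, f n ∈ C n) ∧ Tendsto f atTop (nhds x)}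

/-- The α-cut of a fuzzy set `u`, for α > 0. -/
def acut {m : ℕ} (u : Em m → ℝ) (a : ℝ) : Set (Em m) := {x | a ≤ u x}

/-- The support (0-cut) of a fuzzy set. -/
def fsupp {m : ℕ} (u : Em m → ℝ) : Set (Em m) := closure {x | 0 < u x}

/-- Membership in `F_B(ℝ^m)^p`: normal, upper semi-continuous fuzzy sets with
compact α-cuts for α ∈ (0,1] and α ↦ H([u]_α, {0})^p integrable on (0,1]. -/
structure IsFuzzyBp {m : ℕ} (p : ℝ) (u : Em m → ℝ) : Prop where
  mem01 : ∀ x, u x ∈ Icc (0:ℝ) 1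
  normal : ∃ x, u x = 1
  usc : UpperSemicontinuous u
  compactCuts : ∀ a ∈ Ioc (0:ℝ) 1, IsCompact (acut u a)
  lp : IntegrableOn (fun a => hausdorffDist (acut u a) ({0} : Set (Em m)) ^ p)
        (Ioc (0:ℝ) 1)

/-- Membership in `F_B(ℝ^m)`: normal, upper semi-continuous fuzzy sets with
bounded (hence compact closed) support. -/
structure IsFuzzyB {m : ℕ} (u : Em m → ℝ) : Prop where
  mem01 : ∀ x, u x ∈ Icc (0:ℝ) 1
  normal : ∃ x, u x = 1
  usc : UpperSemicontinuous u
  bddSupp : Bornology.IsBounded {x | 0 < u x}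

/-- The `d_p` metric on fuzzy sets. -/
def dp {m : ℕ} (p : ℝ) (u v : Em m → ℝ) : ℝ :=
  (∫ a in Ioc (0:ℝ) 1, hausdorffDist (acut u a) (acut v a) ^ p) ^ (1/p)

/-- `d_p` distance to the crisp origin `0̂`. -/
def dpOrigin {m : ℕ} (p : ℝ) (u : Em m → ℝ) : ℝ :=
  (∫ a in Ioc (0:ℝ) 1, hausdorffDist (acut u a) ({0} : Set (Em m)) ^ p) ^ (1/p)

/-- Uniformly p-mean bounded family. -/
def UPMB {m : ℕ} (p : ℝ) (U : Set (Em m → ℝ)) : Prop :=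
  ∃ M : ℝ, ∀ u ∈ U, dpOrigin p u ≤ M

/-- p-mean equi-left-continuous family. -/
def PMELC {m : ℕ} (p : ℝ) (U : Set (Em m → ℝ)) : Prop :=
  ∀ ε > (0:ℝ), ∃ δ > (0:ℝ), ∀ h : ℝ, 0 ≤ h → h < δ → ∀ u ∈ U,
    (∫ a in Ioc h 1, hausdorffDist (acut u a) (acut u (a - h)) ^ p) ^ (1/p) < ε

/-- Truncation `u^{(a)}` of a fuzzy set at level `a`. -/
def ftrunc {m : ℕ} (u : Em m → ℝ) (a : ℝ) : Em m → ℝ :=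
  fun x => if a ≤ u x then u x else 0

/-- The kernel of a fuzzy set: intersection of the kernels of its cuts. -/
def fker {m : ℕ} (u : Em m → ℝ) : Set (Em m) :=
  ⋂ a ∈ Ioc (0:ℝ) 1, kern (acut u a)

/-- The full cut-family of a fuzzy set, with the 0-cut being the support. -/
def cutF {m : ℕ} (u : Em m → ℝ) (a : ℝ) : Set (Em m) :=
  if a = 0 then fsupp u else acut u a

/-- Conditions (i)–(iv) of the representation theorem for `F_B(ℝ^m)^p`. -/
def GoodFamily {m : ℕ} (p : ℝ) (v : ℝ → Set (Em m)) : Prop :=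
  (∀ l ∈ Ioc (0:ℝ) 1, (v l).Nonempty ∧ IsCompact (v l)) ∧
  (∀ l ∈ Ioc (0:ℝ) 1, v l = ⋂ g ∈ Ico (0:ℝ) l, v g) ∧
  (v 0 = closure (⋃ g ∈ Ioc (0:ℝ) 1, v g)) ∧
  IntegrableOn (fun a => hausdorffDist (v a) ({0} : Set (Em m)) ^ p) (Ioc (0:ℝ) 1)


/-- A family of nonempty compact sets, decreasing on `I`. -/
structure Fam {m : ℕ} (A : ℝ → Set (Em m)) (I : Set ℝ) : Prop where
  anti : ∀ a ∈ I, ∀ b ∈ I, a ≤ b → A b ⊆ A a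
  ne : ∀ a ∈ I, (A a).Nonempty
  cpt : ∀ a ∈ I, IsCompact (A a)

/-- `L^p` norm of the Hausdorff distance between two families on `I`. -/
def NH {m : ℕ} (p : ℝ) (I : Set ℝ) (A B : ℝ → Set (Em m)) : ENNReal :=
  eLpNorm (fun a => hausdorffDist (A a) (B a)) (ENNReal.ofReal p) (volume.restrict I)

/-- The constant family `{0}`. -/
def zf (m : ℕ) : ℝ → Set (Em m) := fun _ => {0}

theorem Fam.subset {m : ℕ} {A : ℝ → Set (Em m)} {I J : Set ℝ} (hA : Fam A I) (h : J ⊆ I) :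
    Fam A J :=
  ⟨fun a ha b hb => hA.anti a (h ha) b (h hb), fun a ha => hA.ne a (h ha),
    fun a ha => hA.cpt a (h ha)⟩

theorem zf_fam {m : ℕ} (I : Set ℝ) : Fam (zf m) I :=
  ⟨fun _ _ _ _ _ => Subset.rfl, fun _ _ => ⟨0, rfl⟩, fun _ _ => isCompact_singleton⟩

theorem IsFuzzyBp.fam {m : ℕ} {p : ℝ} {u : Em m → ℝ} (hu : IsFuzzyBp p u) :
    Fam (acut u) (Ioc 0 1) := by
  refine ⟨fun a _ b _ hab x hx => le_trans hab hx, fun a ha => ?_, hu.compactCuts⟩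
  obtain ⟨x, hx⟩ := hu.normal
  exact ⟨x, by simp only [acut, mem_ofPred_eq, hx]; exact ha.2⟩

theorem Fam.shift {m : ℕ} {A : ℝ → Set (Em m)} {h t : ℝ} (hA : Fam A (Ioc 0 t)) :
    Fam (fun a => A (a - h)) (Ioc h (h + t)) := by
  have key : ∀ a ∈ Ioc h (h + t), a - h ∈ Ioc 0 t := fun a ha =>
    ⟨by linarith [ha.1], by linarith [ha.2]⟩
  exact ⟨fun a ha b hb hab => hA.anti _ (key a ha) _ (key b hb) (by linarith),
    fun a ha => hA.ne _ (key a ha), fun a ha => hA.cpt _ (key a ha)⟩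

theorem hed_ne_top {m : ℕ} {A B : Set (Em m)} (hA : A.Nonempty) (hA' : IsCompact A)
    (hB : B.Nonempty) (hB' : IsCompact B) : hausdorffEDist A B ≠ ⊤ :=
  hausdorffEDist_ne_top_of_nonempty_of_bounded hA hB hA'.isBounded hB'.isBounded

theorem Fam.fin {m : ℕ} {A B : ℝ → Set (Em m)} {I : Set ℝ} (hA : Fam A I) (hB : Fam B I)
    {a : ℝ} (ha : a ∈ I) : hausdorffEDist (A a) (B a) ≠ ⊤ :=
  hed_ne_top (hA.ne a ha) (hA.cpt a ha) (hB.ne a ha) (hB.cpt a ha)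

theorem hd_eq_iSup {m : ℕ} {A B : Set (Em m)} (fin : hausdorffEDist A B ≠ ⊤) :
    hausdorffDist A B =
      ⨆ n : ℕ, |infDist (TopologicalSpace.denseSeq (Em m) n) A -
        infDist (TopologicalSpace.denseSeq (Em m) n) B| := by
  have fin' : hausdorffEDist B A ≠ ⊤ := by rwa [hausdorffEDist_comm]
  have hle : ∀ x, |infDist x A - infDist x B| ≤ hausdorffDist A B := by
    intro x
    have h1 := infDist_le_infDist_add_hausdorffDist (x := x) fin
    have h2 := infDist_le_infDist_add_hausdorffDist (x := x) fin'
    rw [hausdorffDist_comm] at h2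
    rw [abs_le]; constructor <;> linarith
  have bdd : BddAbove (range fun n : ℕ => |infDist (TopologicalSpace.denseSeq (Em m) n) A -
        infDist (TopologicalSpace.denseSeq (Em m) n) B|) :=
    ⟨_, by rintro _ ⟨n, rfl⟩; exact hle _⟩
  apply le_antisymm
  · set s := ⨆ n : ℕ, |infDist (TopologicalSpace.denseSeq (Em m) n) A -
        infDist (TopologicalSpace.denseSeq (Em m) n) B| with hs
    have hall : ∀ x, |infDist x A - infDist x B| ≤ s := by
      intro x
      have hcl : IsClosed {x : Em m | |infDist x A - infDist x B| ≤ s} :=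
        isClosed_le (((continuous_infDist_pt A).sub (continuous_infDist_pt B)).abs)
          continuous_const
      have : closure (range (TopologicalSpace.denseSeq (Em m))) ⊆
          {x : Em m | |infDist x A - infDist x B| ≤ s} := by
        apply closure_minimal _ hcl
        rintro _ ⟨n, rfl⟩
        exact le_ciSup bdd n
      exact this ((TopologicalSpace.denseRange_denseSeq (Em m)) x)
    apply hausdorffDist_le_of_infDist (le_trans (abs_nonneg _) (hall 0))
    · intro x hx
      have := hall x
      rw [infDist_zero_of_mem hx, zero_sub, abs_neg] at this
      exact le_trans (le_abs_self _) this
    · intro x hx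
      have := hall x
      rw [infDist_zero_of_mem hx, sub_zero] at this
      exact le_trans (le_abs_self _) this
  · exact ciSup_le fun n => hle _

theorem hd_aesm {m : ℕ} {A B : ℝ → Set (Em m)} {I : Set ℝ} (hI : MeasurableSet I)
    (hA : Fam A I) (hB : Fam B I) :
    AEStronglyMeasurable (fun a => hausdorffDist (A a) (B a)) (volume.restrict I) := by
  have hm : ∀ {C : ℝ → Set (Em m)}, Fam C I → ∀ x,
      AEMeasurable (fun a => infDist x (C a)) (volume.restrict I) := by
    intro C hC x
    apply aemeasurable_restrict_of_monotoneOn hI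
    intro a ha b hb hab
    exact infDist_le_infDist_of_subset (hC.anti a ha b hb hab) (hC.ne b hb)
  have : AEMeasurable (fun a => ⨆ n : ℕ, |infDist (TopologicalSpace.denseSeq (Em m) n) (A a) -
        infDist (TopologicalSpace.denseSeq (Em m) n) (B a)|) (volume.restrict I) := by
    apply AEMeasurable.iSup
    intro n
    exact ((hm hA _).sub (hm hB _)).abs
  refine AEMeasurable.aestronglyMeasurable (this.congr ?_)
  filter_upwards [ae_restrict_mem hI] with a ha
  exact (hd_eq_iSup (hA.fin hB ha)).symm

theorem NH_comm {m : ℕ} (p : ℝ) (I : Set ℝ) (A B : ℝ → Set (Em m)) :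
    NH p I A B = NH p I B A := by
  unfold NH; simp_rw [hausdorffDist_comm]

theorem NH_mono {m : ℕ} (p : ℝ) {I J : Set ℝ} (h : I ⊆ J) (A B : ℝ → Set (Em m)) :
    NH p I A B ≤ NH p J A B :=
  eLpNorm_mono_measure _ (Measure.restrict_mono h le_rfl)

theorem NH_tri {m : ℕ} {p : ℝ} (hp : 1 ≤ p) {A B C : ℝ → Set (Em m)} {I : Set ℝ}
    (hI : MeasurableSet I) (hA : Fam A I) (hB : Fam B I) (hC : Fam C I) :
    NH p I A C ≤ NH p I A B + NH p I B C := by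
  refine le_trans ?_ (eLpNorm_add_le (hd_aesm hI hA hB) (hd_aesm hI hB hC)
    (by rw [← ENNReal.ofReal_one]; exact ENNReal.ofReal_le_ofReal hp))
  apply eLpNorm_mono_ae_real
  filter_upwards [ae_restrict_mem hI] with a ha
  rw [Real.norm_of_nonneg hausdorffDist_nonneg]
  exact hausdorffDist_triangle (hA.fin hB ha)

theorem NH_union {m : ℕ} {p : ℝ} (hp : 1 ≤ p) {A B : ℝ → Set (Em m)} {I J K : Set ℝ}
    (hI : MeasurableSet I) (hJ : MeasurableSet J) (hK : MeasurableSet K) (hKIJ : K ⊆ I ∪ J)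
    (hI' : I ⊆ K) (hJ' : J ⊆ K) (hA : Fam A K) (hB : Fam B K) :
    NH p K A B ≤ NH p I A B + NH p J A B := by
  unfold NH
  set f := fun a => hausdorffDist (A a) (B a) with hf
  have hf0 : ∀ a, 0 ≤ f a := fun a => hausdorffDist_nonneg
  have e : ∀ S, MeasurableSet S → S ⊆ K → eLpNorm f (ENNReal.ofReal p) (volume.restrict S) =
      eLpNorm (S.indicator f) (ENNReal.ofReal p) (volume.restrict K) := by
    intro S hS hSK
    rw [eLpNorm_indicator_eq_eLpNorm_restrict hS, Measure.restrict_restrict hS,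
      inter_eq_left.2 hSK]
  rw [e I hI hI', e J hJ hJ']
  refine le_trans ?_ (eLpNorm_add_le ((hd_aesm hK hA hB).indicator hI)
    ((hd_aesm hK hA hB).indicator hJ)
    (by rw [← ENNReal.ofReal_one]; exact ENNReal.ofReal_le_ofReal hp))
  apply eLpNorm_mono_ae_real
  filter_upwards [ae_restrict_mem hK] with a ha
  rw [Real.norm_of_nonneg (hf0 a)]
  have i1 : 0 ≤ I.indicator f a := indicator_nonneg (fun a _ => hf0 a) a
  have i2 : 0 ≤ J.indicator f a := indicator_nonneg (fun a _ => hf0 a) a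
  simp only [Pi.add_apply]
  rcases hKIJ ha with h | h
  · rw [indicator_of_mem h]; linarith
  · rw [indicator_of_mem h]; linarith

theorem NH_shift {m : ℕ} {p : ℝ} {A B : ℝ → Set (Em m)} {h t : ℝ}
    (hA : Fam A (Ioc 0 t)) (hB : Fam B (Ioc 0 t)) :
    NH p (Ioc h (h + t)) (fun a => A (a - h)) (fun a => B (a - h)) = NH p (Ioc 0 t) A B := by
  have mp := (measurePreserving_sub_right (volume : Measure ℝ) h).restrict_preimage
    (measurableSet_Ioc (a := (0:ℝ)) (b := t))
  have hpre : (fun x : ℝ => x - h) ⁻¹' (Ioc 0 t) = Ioc h (h + t) := by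
    ext x; simp only [mem_preimage, mem_Ioc]; constructor <;> rintro ⟨h1, h2⟩ <;>
      constructor <;> linarith
  rw [hpre] at mp
  exact eLpNorm_comp_measurePreserving (hd_aesm measurableSet_Ioc hA hB) mp

theorem bridge {p : ℝ} (hp : 1 ≤ p) {f : ℝ → ℝ} {μ : Measure ℝ} (hf : AEStronglyMeasurable f μ)
    (h0 : ∀ a, 0 ≤ f a) :
    (∫ a, f a ^ p ∂μ) ^ (1 / p) = (eLpNorm f (ENNReal.ofReal p) μ).toReal := by
  have hp0 : 0 < p := by linarith
  have hm : AEStronglyMeasurable (fun a => f a ^ p) μ :=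
    (hf.aemeasurable.pow_const p).aestronglyMeasurable
  rw [eLpNorm_eq_lintegral_rpow_enorm_toReal (by simpa using hp0) ENNReal.ofReal_ne_top,
    ENNReal.toReal_ofReal hp0.le, ← ENNReal.toReal_rpow,
    integral_eq_lintegral_of_nonneg_ae (Eventually.of_forall fun a => Real.rpow_nonneg (h0 a) p) hm]
  congr 3
  funext a
  rw [Real.enorm_of_nonneg (h0 a), ENNReal.ofReal_rpow_of_nonneg (h0 a) hp0.le]

theorem integrable_iff {p : ℝ} (hp : 1 ≤ p) {f : ℝ → ℝ} {μ : Measure ℝ}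
    (hf : AEStronglyMeasurable f μ) (h0 : ∀ a, 0 ≤ f a) :
    Integrable (fun a => f a ^ p) μ ↔ eLpNorm f (ENNReal.ofReal p) μ ≠ ⊤ := by
  have hp0 : 0 < p := by linarith
  have := integrable_norm_rpow_iff (p := ENNReal.ofReal p) hf (by simpa using hp0)
    ENNReal.ofReal_ne_top
  rw [ENNReal.toReal_ofReal hp0.le] at this
  simp only [fun a => Real.norm_of_nonneg (h0 a)] at this
  rw [this]
  exact ⟨fun h => h.2.ne, fun h => ⟨hf, lt_top_iff_ne_top.2 h⟩⟩

theorem NH_zero_fin {m : ℕ} {p : ℝ} (hp : 1 ≤ p) {u : Em m → ℝ} (hu : IsFuzzyBp p u) :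
    NH p (Ioc 0 1) (acut u) (zf m) ≠ ⊤ :=
  (integrable_iff hp (hd_aesm measurableSet_Ioc hu.fam (zf_fam _))
    (fun _ => hausdorffDist_nonneg)).1 hu.lp

theorem NH_fin {m : ℕ} {p : ℝ} (hp : 1 ≤ p) {u v : Em m → ℝ} (hu : IsFuzzyBp p u)
    (hv : IsFuzzyBp p v) : NH p (Ioc 0 1) (acut u) (acut v) ≠ ⊤ := by
  have := NH_tri hp measurableSet_Ioc hu.fam (zf_fam _) hv.fam
  refine ne_top_of_le_ne_top (ENNReal.add_ne_top.2 ⟨NH_zero_fin hp hu, ?_⟩) this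
  rw [NH_comm]; exact NH_zero_fin hp hv

theorem dp_eq {m : ℕ} {p : ℝ} (hp : 1 ≤ p) {u v : Em m → ℝ} (hu : IsFuzzyBp p u)
    (hv : IsFuzzyBp p v) : dp p u v = (NH p (Ioc 0 1) (acut u) (acut v)).toReal :=
  bridge hp (hd_aesm measurableSet_Ioc hu.fam hv.fam) (fun _ => hausdorffDist_nonneg)

theorem dpOrigin_eq {m : ℕ} {p : ℝ} (hp : 1 ≤ p) {u : Em m → ℝ} (hu : IsFuzzyBp p u) :
    dpOrigin p u = (NH p (Ioc 0 1) (acut u) (zf m)).toReal :=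
  bridge hp (hd_aesm measurableSet_Ioc hu.fam (zf_fam _)) (fun _ => hausdorffDist_nonneg)

theorem dp_lt_iff {m : ℕ} {p : ℝ} (hp : 1 ≤ p) {u v : Em m → ℝ} (hu : IsFuzzyBp p u)
    (hv : IsFuzzyBp p v) {e : ℝ} :
    dp p u v < e ↔ NH p (Ioc 0 1) (acut u) (acut v) < ENNReal.ofReal e := by
  rw [dp_eq hp hu hv, ENNReal.lt_ofReal_iff_toReal_lt (NH_fin hp hu hv)]

theorem dp_tri {m : ℕ} {p : ℝ} (hp : 1 ≤ p) {u v w : Em m → ℝ} (hu : IsFuzzyBp p u)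
    (hv : IsFuzzyBp p v) (hw : IsFuzzyBp p w) : dp p u w ≤ dp p u v + dp p v w := by
  rw [dp_eq hp hu hv, dp_eq hp hu hw, dp_eq hp hv hw,
    ← ENNReal.toReal_add (NH_fin hp hu hv) (NH_fin hp hv hw)]
  exact ENNReal.toReal_mono (ENNReal.add_ne_top.2 ⟨NH_fin hp hu hv, NH_fin hp hv hw⟩)
    (NH_tri hp measurableSet_Ioc hu.fam hv.fam hw.fam)

theorem dp_comm {m : ℕ} (p : ℝ) (u v : Em m → ℝ) : dp p u v = dp p v u := by
  unfold dp; simp_rw [hausdorffDist_comm]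

theorem fam_shift' {m : ℕ} {p : ℝ} {u : Em m → ℝ} (hu : IsFuzzyBp p u) {h : ℝ} (h0 : 0 ≤ h) :
    Fam (fun a => acut u (a - h)) (Ioc h 1) :=
  (hu.fam.shift (h := h)).subset (Ioc_subset_Ioc_right (by linarith))

theorem shift_fin {m : ℕ} {p : ℝ} (hp : 1 ≤ p) {u : Em m → ℝ} (hu : IsFuzzyBp p u) {h : ℝ}
    (h0 : 0 ≤ h) : NH p (Ioc h 1) (acut u) (fun a => acut u (a - h)) ≠ ⊤ := by
  have h1 := NH_tri hp measurableSet_Ioc (hu.fam.subset (Ioc_subset_Ioc_left h0)) (zf_fam _)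
    (fam_shift' hu h0)
  refine ne_top_of_le_ne_top (ENNReal.add_ne_top.2 ⟨?_, ?_⟩) h1
  · exact ne_top_of_le_ne_top (NH_zero_fin hp hu) (NH_mono p (Ioc_subset_Ioc_left h0) _ _)
  · rw [NH_comm]
    have h2 := NH_shift (p := p) (h := h) hu.fam (zf_fam (m := m) (Ioc 0 1))
    refine ne_top_of_le_ne_top (NH_zero_fin hp hu) (le_trans ?_ h2.le)
    exact NH_mono p (Ioc_subset_Ioc_right (by linarith)) _ _

/-- Restatement of equi-left-continuity. -/
theorem pmelc_iff {m : ℕ} {p : ℝ} (hp : 1 ≤ p) {u : Em m → ℝ} (hu : IsFuzzyBp p u) {h : ℝ}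
    (h0 : 0 ≤ h) {e : ℝ} :
    (∫ a in Ioc h 1, hausdorffDist (acut u a) (acut u (a - h)) ^ p) ^ (1/p) < e ↔
      NH p (Ioc h 1) (acut u) (fun a => acut u (a - h)) < ENNReal.ofReal e := by
  rw [bridge hp (hd_aesm measurableSet_Ioc (hu.fam.subset (Ioc_subset_Ioc_left h0))
    (fam_shift' hu h0)) (fun _ => hausdorffDist_nonneg),
    ENNReal.lt_ofReal_iff_toReal_lt (shift_fin hp hu h0)]
  rfl

theorem seq_to_tb {m : ℕ} {p : ℝ} (hp : 1 ≤ p) {U : Set (Em m → ℝ)}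
    (hU : ∀ u ∈ U, IsFuzzyBp p u)
    (H : ∀ f : ℕ → (Em m → ℝ), (∀ n, f n ∈ U) →
            ∃ (φ : ℕ → ℕ) (v : Em m → ℝ), StrictMono φ ∧ IsFuzzyBp p v ∧
              Tendsto (fun n => dp p (f (φ n)) v) atTop (nhds 0)) :
    ∀ ε > (0:ℝ), ∃ S : Finset (Em m → ℝ), ↑S ⊆ U ∧ ∀ u ∈ U, ∃ v ∈ S, dp p u v < ε := by
  intro ε hε
  by_contra! hcon
  obtain ⟨f, hf, hfr⟩ := exists_seq_of_forall_finset_exists (fun u => u ∈ U)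
    (fun v u => ε ≤ dp p u v) (fun S hS => hcon S hS)
  obtain ⟨φ, v, hφ, hv, hlim⟩ := H f hf
  obtain ⟨N, hN⟩ := eventually_atTop.1 (hlim.eventually (gt_mem_nhds (half_pos hε)))
  have h1 := hN N le_rfl
  have h2 := hN (N + 1) (Nat.le_succ N)
  have h3 := hfr (φ N) (φ (N + 1)) (hφ (Nat.lt_succ_self N))
  have h4 := dp_tri hp (hU _ (hf (φ (N + 1)))) hv (hU _ (hf (φ N)))
  rw [dp_comm p v] at h4
  linarith

theorem dct {p : ℝ} (hp : 1 ≤ p) {μ : Measure ℝ} [IsFiniteMeasure μ] {f : ℕ → ℝ → ℝ} {C : ℝ}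
    (hm : ∀ n, AEStronglyMeasurable (f n) μ) (hC : ∀ n, ∀ᵐ a ∂μ, ‖f n a‖ ≤ C)
    (hl : ∀ᵐ a ∂μ, Tendsto (fun n => f n a) atTop (nhds 0)) :
    Tendsto (fun n => eLpNorm (f n) (ENNReal.ofReal p) μ) atTop (nhds 0) := by
  have hp0 : 0 < p := by linarith
  simp_rw [eLpNorm_eq_lintegral_rpow_enorm_toReal (p := ENNReal.ofReal p) (by simpa using hp0)
    ENNReal.ofReal_ne_top, ENNReal.toReal_ofReal hp0.le]
  have key : Tendsto (fun n => ∫⁻ a, ‖f n a‖ₑ ^ p ∂μ) atTop (nhds (∫⁻ _, 0 ∂μ)) := by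
    apply tendsto_lintegral_of_dominated_convergence' (fun _ => ENNReal.ofReal C ^ p)
    · intro n; exact (hm n).enorm.pow_const p
    · intro n
      filter_upwards [hC n] with a ha
      refine ENNReal.rpow_le_rpow ?_ hp0.le
      rw [← ofReal_norm]; exact ENNReal.ofReal_le_ofReal ha
    · rw [lintegral_const]
      exact ENNReal.mul_ne_top (ENNReal.rpow_ne_top_of_nonneg hp0.le ENNReal.ofReal_ne_top)
        (measure_ne_top _ _)
    · filter_upwards [hl] with a ha
      have := (ENNReal.continuous_rpow_const (y := p)).tendsto 0 |>.comp
        ((continuous_enorm.tendsto (0:ℝ)).comp ha |>.mono_right (by simp))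
      rw [ENNReal.zero_rpow_of_pos hp0] at this
      exact this
  rw [lintegral_zero] at key
  have := ((ENNReal.continuous_rpow_const (y := 1 / p)).tendsto 0).comp key
  rw [ENNReal.zero_rpow_of_pos (by positivity)] at this
  exact this

theorem left_cont {m : ℕ} {u : Em m → ℝ} (hc : ∀ a ∈ Ioc (0:ℝ) 1, IsCompact (acut u a))
    {a : ℝ} (ha : a ∈ Ioc (0:ℝ) 1) {ε : ℝ} (hε : 0 < ε) :
    ∃ b ∈ Ioo 0 a, acut u b ⊆ thickening ε (acut u a) := by
  have : Nonempty (Ioo (0:ℝ) a) := ⟨⟨a / 2, by constructor <;> linarith [ha.1]⟩⟩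
  suffices H : ∃ i : Ioo (0:ℝ) a, acut u i ⊆ thickening ε (acut u a) by
    obtain ⟨⟨b, hb⟩, hb'⟩ := H
    exact ⟨b, hb, hb'⟩
  refine exists_subset_nhds_of_isCompact (V := fun b : Ioo (0:ℝ) a => acut u b) ?_ ?_ ?_
  · intro x y
    refine ⟨max x y, ?_, ?_⟩
    · intro z hz
      have hz' : ((max x y : Ioo (0:ℝ) a) : ℝ) ≤ u z := hz
      exact le_trans (Subtype.coe_le_coe.2 (le_max_left x y)) hz'
    · intro z hz
      have hz' : ((max x y : Ioo (0:ℝ) a) : ℝ) ≤ u z := hz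
      exact le_trans (Subtype.coe_le_coe.2 (le_max_right x y)) hz'
  · intro b
    exact hc b ⟨b.2.1, le_trans b.2.2.le ha.2⟩
  · intro x hx
    apply isOpen_thickening.mem_nhds
    apply self_subset_thickening hε
    simp only [mem_iInter] at hx
    change a ≤ u x
    apply le_of_forall_lt
    intro c hc
    by_cases h0 : c ≤ 0
    · obtain ⟨⟨b, hb⟩⟩ := this
      exact lt_of_le_of_lt h0 (lt_of_lt_of_le hb.1 (hx ⟨b, hb⟩))
    · push Not at h0
      have := hx ⟨(c + a) / 2, by constructor <;> linarith⟩
      have h2 : (c + a) / 2 ≤ u x := this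
      linarith

theorem norm_le_hd {m : ℕ} {A : Set (Em m)} (hA' : IsCompact A)
    {x : Em m} (hx : x ∈ A) : ‖x‖ ≤ hausdorffDist A {0} := by
  have := infDist_le_hausdorffDist_of_mem hx
    (hed_ne_top ⟨x, hx⟩ hA' (singleton_nonempty (0 : Em m)) isCompact_singleton)
  simpa using this

theorem hd_zero_le {m : ℕ} {A : Set (Em m)} {R : ℝ} (hR : 0 ≤ R) (hne : A.Nonempty)
    (h : ∀ x ∈ A, ‖x‖ ≤ R) : hausdorffDist A {0} ≤ R := by
  apply hausdorffDist_le_of_mem_dist hR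
  · intro x hx; exact ⟨0, rfl, by simpa using h x hx⟩
  · intro x hx
    obtain ⟨y, hy⟩ := hne
    rw [mem_singleton_iff.1 hx]
    exact ⟨y, hy, by simpa using h y hy⟩

theorem hd_zero_anti {m : ℕ} {A : ℝ → Set (Em m)} {I : Set ℝ} (hA : Fam A I) {a b : ℝ}
    (ha : a ∈ I) (hb : b ∈ I) (hab : a ≤ b) :
    hausdorffDist (A b) {0} ≤ hausdorffDist (A a) {0} :=
  hd_zero_le hausdorffDist_nonneg (hA.ne b hb)
    fun _ hx => norm_le_hd (hA.cpt a ha) (hA.anti a ha b hb hab hx)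

theorem hd_le_of_zero {m : ℕ} {A B : Set (Em m)} (hA : A.Nonempty) (hA' : IsCompact A) :
    hausdorffDist A B ≤ hausdorffDist A {0} + hausdorffDist B {0} := by
  rw [hausdorffDist_comm (s := B)]
  exact hausdorffDist_triangle (hed_ne_top hA hA' (singleton_nonempty _) isCompact_singleton)

theorem single_tail {m : ℕ} {p : ℝ} (hp : 1 ≤ p) {u : Em m → ℝ} (hu : IsFuzzyBp p u)
    {ε : ℝ} (hε : 0 < ε) :
    ∃ η ∈ Ioc (0:ℝ) 1, NH p (Ioc 0 η) (acut u) (zf m) ≤ ENNReal.ofReal ε := by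
  have hM : MemLp (fun a => hausdorffDist (acut u a) (zf m a)) (ENNReal.ofReal p)
      (volume.restrict (Ioc 0 1)) :=
    ⟨hd_aesm measurableSet_Ioc hu.fam (zf_fam _), lt_top_iff_ne_top.2 (NH_zero_fin hp hu)⟩
  obtain ⟨δ, hδ, h⟩ := hM.eLpNorm_indicator_le
    (by rw [← ENNReal.ofReal_one]; exact ENNReal.ofReal_le_ofReal hp) ENNReal.ofReal_ne_top hε
  refine ⟨min δ 1, ⟨by positivity, min_le_right _ _⟩, ?_⟩
  have hs : Ioc 0 (min δ 1) ⊆ Ioc (0:ℝ) 1 := Ioc_subset_Ioc_right (min_le_right _ _)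
  have := h (Ioc 0 (min δ 1)) measurableSet_Ioc (by
    rw [Measure.restrict_apply measurableSet_Ioc, inter_eq_left.2 hs, Real.volume_Ioc]
    exact ENNReal.ofReal_le_ofReal (by simp))
  rwa [eLpNorm_indicator_eq_eLpNorm_restrict measurableSet_Ioc,
    Measure.restrict_restrict measurableSet_Ioc, inter_eq_left.2 hs] at this

/-- Bound of the shifted distance on a tail near the left end. -/
theorem shift_tail {m : ℕ} {p : ℝ} (hp : 1 ≤ p) {u : Em m → ℝ} (hu : IsFuzzyBp p u)
    {h η : ℝ} (h0 : 0 ≤ h) (hη : η ≤ 1) :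
    NH p (Ioc h η) (acut u) (fun a => acut u (a - h)) ≤
      NH p (Ioc 0 η) (acut u) (zf m) + NH p (Ioc 0 η) (acut u) (zf m) := by
  have hs : Ioc h η ⊆ Ioc h 1 := Ioc_subset_Ioc_right hη
  refine le_trans (NH_tri hp measurableSet_Ioc
    (hu.fam.subset (hs.trans (Ioc_subset_Ioc_left h0))) (zf_fam _)
    ((fam_shift' hu h0).subset hs)) ?_
  gcongr
  · exact NH_mono p (Ioc_subset_Ioc_left h0) _ _
  · rw [NH_comm]
    have h2 := NH_shift (p := p) (h := h) (hu.fam.subset (Ioc_subset_Ioc_right hη))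
      (zf_fam (m := m) (Ioc 0 η))
    refine le_trans ?_ h2.le
    exact NH_mono p (Ioc_subset_Ioc_right (by linarith)) _ _

theorem shift_core {m : ℕ} {p : ℝ} (hp : 1 ≤ p) {u : Em m → ℝ} (hu : IsFuzzyBp p u)
    {η : ℝ} (hη : η ∈ Ioc (0:ℝ) 1) {h : ℕ → ℝ} (h0 : ∀ n, 0 ≤ h n) (h1 : ∀ n, h n ≤ η / 2)
    (hl : Tendsto h atTop (nhds 0)) :
    Tendsto (fun n => NH p (Ioc η 1) (acut u) (fun a => acut u (a - h n))) atTop (nhds 0) := by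
  have hη0 := hη.1
  have hη1 := hη.2
  have hmem : ∀ n, ∀ a ∈ Ioc η 1, a - h n ∈ Ioc (0:ℝ) 1 ∧ η / 2 ≤ a - h n := by
    intro n a ha
    have := h0 n; have := h1 n
    exact ⟨⟨by linarith [ha.1], by linarith [ha.2]⟩, by linarith [ha.1]⟩
  have hsub : Ioc η 1 ⊆ Ioc (0:ℝ) 1 := Ioc_subset_Ioc_left hη0.le
  have h2 : η / 2 ∈ Ioc (0:ℝ) 1 := ⟨by linarith, by linarith⟩
  apply dct hp (C := hausdorffDist (acut u (η / 2)) {0} + hausdorffDist (acut u (η / 2)) {0})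
  · intro n
    apply hd_aesm measurableSet_Ioc (hu.fam.subset hsub)
    exact (fam_shift' hu (h0 n)).subset (Ioc_subset_Ioc_left (by linarith [h1 n]))
  · intro n
    filter_upwards [ae_restrict_mem measurableSet_Ioc] with a ha
    rw [Real.norm_of_nonneg hausdorffDist_nonneg]
    refine le_trans (hd_le_of_zero (hu.fam.ne a (hsub ha)) (hu.fam.cpt a (hsub ha))) ?_
    gcongr
    · exact hd_zero_anti hu.fam h2 (hsub ha) (by linarith [ha.1])
    · exact hd_zero_anti hu.fam h2 (hmem n a ha).1 (hmem n a ha).2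
  · filter_upwards [ae_restrict_mem measurableSet_Ioc] with a ha
    rw [Metric.tendsto_atTop]
    intro ε hε
    obtain ⟨b, hb, hb'⟩ := left_cont hu.compactCuts (hsub ha) (half_pos hε)
    obtain ⟨N, hN⟩ := eventually_atTop.1 (hl.eventually (gt_mem_nhds (sub_pos.2 hb.2)))
    refine ⟨N, fun n hn => ?_⟩
    rw [Real.dist_eq, sub_zero, abs_of_nonneg hausdorffDist_nonneg]
    refine lt_of_le_of_lt ?_ (half_lt_self hε)
    apply hausdorffDist_le_of_mem_dist (half_pos hε).le
    · intro x hx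
      have hx' : a ≤ u x := hx
      exact ⟨x, show a - h n ≤ u x by linarith [h0 n], by simpa using (half_pos hε).le⟩
    · intro x hx
      have hx' : a - h n ≤ u x := hx
      have := hN n hn
      have hxb : x ∈ acut u b := show b ≤ u x by linarith
      obtain ⟨y, hy, hxy⟩ := mem_thickening_iff.1 (hb' hxb)
      exact ⟨y, hy, hxy.le⟩

theorem single_pmelc {m : ℕ} {p : ℝ} (hp : 1 ≤ p) {u : Em m → ℝ} (hu : IsFuzzyBp p u)
    {ε : ℝ} (hε : 0 < ε) :
    ∃ δ > (0:ℝ), ∀ h : ℝ, 0 ≤ h → h < δ →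
      NH p (Ioc h 1) (acut u) (fun a => acut u (a - h)) < ENNReal.ofReal ε := by
  by_contra! hcon
  have hε4 : 0 < ε / 4 := by linarith
  obtain ⟨η, hη, hηt⟩ := single_tail hp hu hε4
  have hη0 := hη.1
  have : ∀ n : ℕ, 0 < min (η / 2) (1 / ((n:ℝ) + 1)) := fun n => by positivity
  choose h h0 hlt hge using fun n : ℕ => hcon _ (this n)
  have hl : Tendsto h atTop (nhds 0) :=
    squeeze_zero h0 (fun n => (hlt n).le.trans (min_le_right _ _))
      tendsto_one_div_add_atTop_nhds_zero_nat
  have hc := shift_core hp hu hη h0 (fun n => (hlt n).le.trans (min_le_left _ _)) hl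
  obtain ⟨n, hn⟩ := (hc.eventually (gt_mem_nhds
    (show (0:ENNReal) < ENNReal.ofReal (ε / 4) by simpa using hε4))).exists
  have hhη : h n ≤ η := by
    have := (hlt n).le.trans (min_le_left _ _); linarith
  have hu1 := NH_union hp (A := acut u) (B := fun a => acut u (a - h n))
    (I := Ioc (h n) η) (J := Ioc η 1) (K := Ioc (h n) 1) measurableSet_Ioc measurableSet_Ioc
    measurableSet_Ioc (by rw [Ioc_union_Ioc_eq_Ioc hhη hη.2])
    (Ioc_subset_Ioc_right hη.2) (Ioc_subset_Ioc_left hhη)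
    (hu.fam.subset (Ioc_subset_Ioc_left (h0 n))) (fam_shift' hu (h0 n))
  have hs := shift_tail hp hu (h0 n) hη.2
  have : ENNReal.ofReal ε ≤ ENNReal.ofReal (ε / 4) + ENNReal.ofReal (ε / 4) +
      ENNReal.ofReal (ε / 4) := by
    refine le_trans (hge n) (le_trans hu1 ?_)
    gcongr
    exact hs.trans (by gcongr)
  rw [← ENNReal.ofReal_add (by positivity) (by positivity),
    ← ENNReal.ofReal_add (by positivity) (by positivity),
    ENNReal.ofReal_le_ofReal_iff (by positivity)] at this
  linarith

theorem tb_to_bdd {m : ℕ} {p : ℝ} (hp : 1 ≤ p) {U : Set (Em m → ℝ)}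
    (hU : ∀ u ∈ U, IsFuzzyBp p u)
    (H : ∀ ε > (0:ℝ), ∃ S : Finset (Em m → ℝ), ↑S ⊆ U ∧ ∀ u ∈ U, ∃ v ∈ S, dp p u v < ε) :
    UPMB p U ∧ PMELC p U := by
  constructor
  · obtain ⟨S, hS, hSU⟩ := H 1 one_pos
    refine ⟨1 + ∑ v ∈ S, dpOrigin p v, fun u hu => ?_⟩
    obtain ⟨v, hv, huv⟩ := hSU u hu
    have hu' := hU u hu
    have hv' := hU v (hS hv)
    have hn : ∀ w ∈ S, 0 ≤ dpOrigin p w := fun w hw => by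
      rw [dpOrigin_eq hp (hU w (hS hw))]; exact ENNReal.toReal_nonneg
    have h1 := Finset.single_le_sum hn hv
    have h2 : dpOrigin p u ≤ dp p u v + dpOrigin p v := by
      rw [dpOrigin_eq hp hu', dpOrigin_eq hp hv', dp_eq hp hu' hv',
        ← ENNReal.toReal_add (NH_fin hp hu' hv') (NH_zero_fin hp hv')]
      exact ENNReal.toReal_mono (ENNReal.add_ne_top.2 ⟨NH_fin hp hu' hv', NH_zero_fin hp hv'⟩)
        (NH_tri hp measurableSet_Ioc hu'.fam hv'.fam (zf_fam _))
    linarith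
  · intro ε hε
    have hε3 : 0 < ε / 3 := by linarith
    obtain ⟨S, hS, hSU⟩ := H (ε / 3) hε3
    have hex : ∀ v : Em m → ℝ, ∃ δ > (0:ℝ), v ∈ S → ∀ h : ℝ, 0 ≤ h → h < δ →
        NH p (Ioc h 1) (acut v) (fun a => acut v (a - h)) < ENNReal.ofReal (ε / 3) := by
      intro v
      by_cases hv : v ∈ S
      · obtain ⟨δ, hδ, h⟩ := single_pmelc hp (hU v (hS hv)) hε3
        exact ⟨δ, hδ, fun _ => h⟩
      · exact ⟨1, one_pos, fun h => absurd h hv⟩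
    choose δ hδ hδS using hex
    have hmin : ∃ d > (0:ℝ), ∀ v ∈ S, d ≤ δ v := by
      rcases S.eq_empty_or_nonempty with rfl | hne
      · exact ⟨1, one_pos, by simp⟩
      · exact ⟨S.inf' hne δ, by rw [gt_iff_lt, Finset.lt_inf'_iff]; exact fun v _ => hδ v,
          fun v hv => Finset.inf'_le _ hv⟩
    obtain ⟨d, hd, hdS⟩ := hmin
    refine ⟨d, hd, fun h h0 hlt u hu => ?_⟩
    obtain ⟨v, hv, huv⟩ := hSU u hu
    have hu' := hU u hu
    have hv' := hU v (hS hv)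
    rw [pmelc_iff hp hu' h0]
    rw [dp_lt_iff hp hu' hv'] at huv
    have hsub : Ioc h 1 ⊆ Ioc (0:ℝ) 1 := Ioc_subset_Ioc_left h0
    have t1 := NH_tri hp measurableSet_Ioc (hu'.fam.subset hsub) (hv'.fam.subset hsub)
      (fam_shift' hu' h0)
    have t2 := NH_tri hp measurableSet_Ioc (hv'.fam.subset hsub) (fam_shift' hv' h0)
      (fam_shift' hu' h0)
    have t3 := NH_mono p hsub (acut u) (acut v)
    have t4 : NH p (Ioc h 1) (fun a => acut v (a - h)) (fun a => acut u (a - h)) ≤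
        NH p (Ioc 0 1) (acut u) (acut v) := by
      rw [NH_comm]
      have h2 := NH_shift (p := p) (h := h) hu'.fam hv'.fam
      refine le_trans ?_ h2.le
      exact NH_mono p (Ioc_subset_Ioc_right (by linarith)) _ _
    have t5 := hδS v hv h h0 (lt_of_lt_of_le hlt (hdS v hv))
    calc _ ≤ _ := t1
      _ ≤ NH p (Ioc 0 1) (acut u) (acut v) +
          (NH p (Ioc h 1) (acut v) (fun a => acut v (a - h)) +
            NH p (Ioc 0 1) (acut u) (acut v)) := by
          gcongr
          exact t2.trans (by gcongr)
      _ < ENNReal.ofReal (ε / 3) + (ENNReal.ofReal (ε / 3) + ENNReal.ofReal (ε / 3)) :=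
          ENNReal.add_lt_add huv (ENNReal.add_lt_add t5 huv)
      _ = ENNReal.ofReal ε := by
          rw [← ENNReal.ofReal_add (by positivity) (by positivity),
            ← ENNReal.ofReal_add (by positivity) (by positivity)]
          congr 1; ring

theorem const_norm {p : ℝ} (hp : 1 ≤ p) {R a b : ℝ} (hR : 0 ≤ R) (hab : a < b) :
    eLpNorm (fun _ : ℝ => R) (ENNReal.ofReal p) (volume.restrict (Ioc a b)) =
      ENNReal.ofReal (R * (b - a) ^ (1 / p)) := by
  have hp0 : 0 < p := by linarith
  rw [eLpNorm_const R (by simpa using hp0), ENNReal.toReal_ofReal hp0.le,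
    Real.enorm_of_nonneg hR, Measure.restrict_apply_univ, Real.volume_Ioc,
    ENNReal.ofReal_rpow_of_nonneg (by linarith) (by positivity), ENNReal.ofReal_mul hR]
  intro h
  have := congrArg (fun μ => μ univ) h
  simp at this
  linarith

theorem cut_bound {m : ℕ} {p : ℝ} (hp : 1 ≤ p) {U : Set (Em m → ℝ)}
    (hU : ∀ u ∈ U, IsFuzzyBp p u) (hB : UPMB p U) {a : ℝ} (ha : a ∈ Ioc (0:ℝ) 1) :
    ∃ R ≥ (0:ℝ), ∀ u ∈ U, hausdorffDist (acut u a) {0} ≤ R := by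
  obtain ⟨M, hM⟩ := hB
  have ha0 := ha.1
  have hpos : 0 < a ^ (1 / p) := Real.rpow_pos_of_pos ha0 _
  refine ⟨max M 0 / a ^ (1 / p), by positivity, fun u hu => ?_⟩
  have hu' := hU u hu
  rw [le_div_iff₀ hpos]
  have h1 : NH p (Ioc 0 1) (acut u) (zf m) ≤ ENNReal.ofReal (max M 0) := by
    rw [ENNReal.le_ofReal_iff_toReal_le (NH_zero_fin hp hu') (le_max_right _ _),
      ← dpOrigin_eq hp hu']
    exact (hM u hu).trans (le_max_left _ _)
  have h2 := const_norm hp (hausdorffDist_nonneg (s := acut u a) (t := ({0} : Set (Em m)))) ha0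
  have h3 : eLpNorm (fun _ : ℝ => hausdorffDist (acut u a) {0}) (ENNReal.ofReal p)
      (volume.restrict (Ioc 0 a)) ≤ NH p (Ioc 0 a) (acut u) (zf m) := by
    apply eLpNorm_mono_ae_real
    filter_upwards [ae_restrict_mem measurableSet_Ioc] with b hb
    rw [Real.norm_of_nonneg hausdorffDist_nonneg]
    exact hd_zero_anti hu'.fam ⟨hb.1, hb.2.trans ha.2⟩ ha hb.2
  have h4 := (h3.trans (NH_mono p (Ioc_subset_Ioc_right ha.2) _ _)).trans h1
  rw [h2, ENNReal.ofReal_le_ofReal_iff (le_max_right _ _), sub_zero] at h4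
  exact h4

theorem unif_tail {m : ℕ} {p : ℝ} (hp : 1 ≤ p) {U : Set (Em m → ℝ)}
    (hU : ∀ u ∈ U, IsFuzzyBp p u) (hB : UPMB p U) (hL : PMELC p U) {ε : ℝ} (hε : 0 < ε) :
    ∃ η ∈ Ioc (0:ℝ) 1, ∀ u ∈ U, NH p (Ioc 0 η) (acut u) (zf m) ≤ ENNReal.ofReal ε := by
  have hp0 : 0 < p := by linarith
  obtain ⟨δ, hδ, hδU⟩ := hL (ε / 2) (half_pos hε)
  set h := min (δ / 2) (1 / 2) with hh
  have h0 : 0 < h := by positivity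
  have hhalf : h ≤ 1 / 2 := min_le_right _ _
  have hhδ : h < δ := lt_of_le_of_lt (min_le_left _ _) (half_lt_self hδ)
  have hmem : h ∈ Ioc (0:ℝ) 1 := ⟨h0, by linarith⟩
  obtain ⟨R, hR, hRU⟩ := cut_bound hp hU hB hmem
  set c := ε / (2 * (R + 1)) with hc
  have hc0 : 0 < c := by positivity
  set η := min (1 / 2) (c ^ p) with hη
  have hη0 : 0 < η := lt_min (by norm_num) (Real.rpow_pos_of_pos hc0 p)
  have hη1 : η ≤ 1 / 2 := min_le_left _ _
  have hηp : η ^ (1 / p) ≤ c := by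
    have := Real.rpow_le_rpow hη0.le (min_le_right (1 / 2) (c ^ p)) (show 0 ≤ 1 / p by positivity)
    rwa [← Real.rpow_mul hc0.le, mul_one_div_cancel hp0.ne', Real.rpow_one] at this
  have hRη : R * η ^ (1 / p) ≤ ε / 2 := by
    calc R * η ^ (1 / p) ≤ (R + 1) * c := by gcongr; linarith
      _ = ε / 2 := by rw [hc]; field_simp
  refine ⟨η, ⟨hη0, by linarith⟩, fun u hu => ?_⟩
  have hu' := hU u hu
  have hsub : Ioc h (h + η) ⊆ Ioc h 1 := Ioc_subset_Ioc_right (by linarith)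
  have hsub' : Ioc h (h + η) ⊆ Ioc 0 1 := hsub.trans (Ioc_subset_Ioc_left h0.le)
  have e := NH_shift (p := p) (h := h)
    (hu'.fam.subset (Ioc_subset_Ioc_right (show η ≤ 1 by linarith))) (zf_fam (m := m) (Ioc 0 η))
  rw [← e]
  refine le_trans (NH_tri hp measurableSet_Ioc ((fam_shift' hu' h0.le).subset hsub)
    (hu'.fam.subset hsub') (zf_fam _)) ?_
  have t1 : NH p (Ioc h (h + η)) (fun a => acut u (a - h)) (acut u) ≤ ENNReal.ofReal (ε / 2) := by
    rw [NH_comm]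
    exact (NH_mono p hsub _ _).trans ((pmelc_iff hp hu' h0.le).1 (hδU h h0.le hhδ u hu)).le
  have t2 : NH p (Ioc h (h + η)) (acut u) (zf m) ≤ ENNReal.ofReal (ε / 2) := by
    have h2 := const_norm hp hR (show h < h + η by linarith)
    refine le_trans (?_ : _ ≤ eLpNorm (fun _ : ℝ => R) (ENNReal.ofReal p)
      (volume.restrict (Ioc h (h + η)))) ?_
    · apply eLpNorm_mono_ae_real
      filter_upwards [ae_restrict_mem measurableSet_Ioc] with b hb
      rw [Real.norm_of_nonneg hausdorffDist_nonneg]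
      exact (hd_zero_anti hu'.fam hmem (hsub' hb) hb.1.le).trans (hRU u hu)
    · rw [h2]
      apply ENNReal.ofReal_le_ofReal
      rwa [add_sub_cancel_left]
  refine (add_le_add t1 t2).trans ?_
  rw [← ENNReal.ofReal_add (by positivity) (by positivity), add_halves]

open TopologicalSpace in
theorem extract {m : ℕ} {p : ℝ} (hp : 1 ≤ p) {U : Set (Em m → ℝ)}
    (hU : ∀ u ∈ U, IsFuzzyBp p u) (hB : UPMB p U) {f : ℕ → Em m → ℝ} (hf : ∀ n, f n ∈ U) :
    ∃ (φ : ℕ → ℕ) (L : ℚ → NonemptyCompacts (Em m)), StrictMono φ ∧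
      ∀ q : ℚ, (q : ℝ) ∈ Ioc (0:ℝ) 1 →
        Tendsto (fun n => hausdorffDist (acut (f (φ n)) q) (L q : Set (Em m))) atTop (nhds 0) := by
  classical
  have hR : ∀ q : ℚ, ∃ R : ℝ, (q : ℝ) ∈ Ioc (0:ℝ) 1 → ∀ u ∈ U,
      hausdorffDist (acut u q) {0} ≤ R := by
    intro q
    by_cases hq : (q : ℝ) ∈ Ioc (0:ℝ) 1
    · obtain ⟨R, -, h⟩ := cut_bound hp hU hB hq
      exact ⟨R, fun _ => h⟩
    · exact ⟨0, fun h => absurd h hq⟩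
  choose R hRU using hR
  let K : ℕ → ℚ → NonemptyCompacts (Em m) := fun n q =>
    if h : (q : ℝ) ∈ Ioc (0:ℝ) 1 then
      ⟨⟨acut (f n) q, (hU _ (hf n)).fam.cpt _ h⟩, (hU _ (hf n)).fam.ne _ h⟩
    else ⟨⟨{0}, isCompact_singleton⟩, singleton_nonempty _⟩
  have hcpt : IsCompact (univ.pi fun q : ℚ =>
      {L : NonemptyCompacts (Em m) | (L : Set (Em m)) ⊆ closedBall 0 (max (R q) 0)}) :=
    isCompact_univ_pi fun q =>
      NonemptyCompacts.isCompact_subsets_of_isCompact (isCompact_closedBall _ _)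
  have hK : ∀ n, K n ∈ univ.pi fun q : ℚ =>
      {L : NonemptyCompacts (Em m) | (L : Set (Em m)) ⊆ closedBall 0 (max (R q) 0)} := by
    intro n q _
    change ((K n q : NonemptyCompacts (Em m)) : Set (Em m)) ⊆ _
    by_cases h : (q : ℝ) ∈ Ioc (0:ℝ) 1
    · simp only [K, dif_pos h]
      intro x hx
      rw [mem_closedBall_zero_iff]
      have := norm_le_hd ((hU _ (hf n)).fam.cpt _ h) hx
      exact this.trans ((hRU q h _ (hf n)).trans (le_max_left _ _))
    · simp only [K, dif_neg h]
      intro x hx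
      have : x = 0 := hx
      simp [this]
  obtain ⟨L, -, φ, hφ, hlim⟩ := hcpt.tendsto_subseq hK
  refine ⟨φ, L, hφ, fun q hq => ?_⟩
  have h1 := (tendsto_pi_nhds.1 hlim) q
  rw [tendsto_iff_dist_tendsto_zero] at h1
  refine h1.congr fun n => ?_
  rw [NonemptyCompacts.dist_eq]
  simp only [Function.comp, K, dif_pos hq]
  rfl

open TopologicalSpace in
theorem limit_anti {m : ℕ} {p : ℝ} {f : ℕ → Em m → ℝ} (hf : ∀ n, IsFuzzyBp p (f n))
    {L : ℚ → NonemptyCompacts (Em m)}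
    (hL : ∀ q : ℚ, (q : ℝ) ∈ Ioc (0:ℝ) 1 →
        Tendsto (fun n => hausdorffDist (acut (f n) q) (L q : Set (Em m))) atTop (nhds 0))
    {q r : ℚ} (hq : (q : ℝ) ∈ Ioc (0:ℝ) 1) (hr : (r : ℝ) ∈ Ioc (0:ℝ) 1) (hqr : q ≤ r) :
    (L r : Set (Em m)) ⊆ L q := by
  intro x hx
  rw [← (L q).isCompact.isClosed.closure_eq, Metric.mem_closure_iff]
  intro ε hε
  obtain ⟨n, hn1, hn2⟩ := (((hL q hq).eventually (gt_mem_nhds (half_pos hε))).and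
    ((hL r hr).eventually (gt_mem_nhds (half_pos hε)))).exists
  obtain ⟨y, hy, hxy⟩ := exists_dist_lt_of_hausdorffDist_lt' hx hn2
    (hed_ne_top ((hf n).fam.ne _ hr) ((hf n).fam.cpt _ hr) (L r).nonempty (L r).isCompact)
  have hy' : y ∈ acut (f n) q := (hf n).fam.anti _ hq _ hr (by exact_mod_cast hqr) hy
  obtain ⟨z, hz, hyz⟩ := exists_dist_lt_of_hausdorffDist_lt hy' hn1
    (hed_ne_top ((hf n).fam.ne _ hq) ((hf n).fam.cpt _ hq) (L q).nonempty (L q).isCompact)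
  refine ⟨z, hz, ?_⟩
  have := dist_triangle x y z
  rw [dist_comm y x] at hxy
  linarith

open TopologicalSpace in
theorem limit_exists {m : ℕ} {L : ℚ → NonemptyCompacts (Em m)}
    (hanti : ∀ q r : ℚ, (q : ℝ) ∈ Ioc (0:ℝ) 1 → (r : ℝ) ∈ Ioc (0:ℝ) 1 → q ≤ r →
      (L r : Set (Em m)) ⊆ L q) :
    ∃ v : Em m → ℝ, (∀ x, v x ∈ Icc (0:ℝ) 1) ∧ (∃ x, v x = 1) ∧ UpperSemicontinuous v ∧
      (∀ a ∈ Ioc (0:ℝ) 1, IsCompact (acut v a)) ∧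
      (∀ q : ℚ, (q : ℝ) ∈ Ioc (0:ℝ) 1 → (L q : Set (Em m)) ⊆ acut v q) ∧
      (∀ q : ℚ, (q : ℝ) ∈ Ioc (0:ℝ) 1 → ∀ a : ℝ, q < a → acut v a ⊆ L q) := by
  let T : Em m → Set ℝ := fun x => {0} ∪ {a | ∃ q : ℚ, (q : ℝ) = a ∧ a ∈ Ioc (0:ℝ) 1 ∧ x ∈ L q}
  have hT : ∀ x, ∀ a ∈ T x, a ∈ Icc (0:ℝ) 1 := by
    rintro x a (h | ⟨q, -, h, -⟩)
    · rw [mem_singleton_iff.1 h]; exact ⟨le_rfl, zero_le_one⟩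
    · exact ⟨h.1.le, h.2⟩
  have h0T : ∀ x, (0:ℝ) ∈ T x := fun x => Or.inl rfl
  have hbdd : ∀ x, BddAbove (T x) := fun x => ⟨1, fun a ha => (hT x a ha).2⟩
  let v : Em m → ℝ := fun x => sSup (T x)
  have hv01 : ∀ x, v x ∈ Icc (0:ℝ) 1 := fun x =>
    ⟨le_csSup (hbdd x) (h0T x), csSup_le ⟨0, h0T x⟩ fun a ha => (hT x a ha).2⟩
  have h1 : ∀ q : ℚ, (q : ℝ) ∈ Ioc (0:ℝ) 1 → (L q : Set (Em m)) ⊆ acut v q := by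
    intro q hq x hx
    exact le_csSup (hbdd x) (Or.inr ⟨q, rfl, hq, hx⟩)
  have h2 : ∀ q : ℚ, (q : ℝ) ∈ Ioc (0:ℝ) 1 → ∀ a : ℝ, q < a → acut v a ⊆ L q := by
    intro q hq a hqa x hx
    have hx' : a ≤ v x := hx
    obtain ⟨b, hb, hqb⟩ := exists_lt_of_lt_csSup ⟨0, h0T x⟩ (lt_of_lt_of_le hqa hx')
    rcases hb with hb | ⟨r, rfl, hr, hxr⟩
    · rw [mem_singleton_iff.1 hb] at hqb
      exact absurd hqb (not_lt.2 hq.1.le)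
    · exact hanti q r hq hr (by exact_mod_cast hqb.le) hxr
  have hc : ∀ a ∈ Ioc (0:ℝ) 1, IsCompact (acut v a) := by
    intro a ha
    have heq : acut v a = ⋂ q : {q : ℚ // (q : ℝ) ∈ Ioc (0:ℝ) 1 ∧ (q : ℝ) < a},
        (L q : Set (Em m)) := by
      apply Subset.antisymm
      · exact subset_iInter fun q => h2 q q.2.1 a q.2.2
      · intro x hx
        rw [mem_iInter] at hx
        change a ≤ v x
        by_contra! hlt
        obtain ⟨q, hq1, hq2⟩ := exists_rat_btwn hlt
        have hq0 : (q : ℝ) ∈ Ioc (0:ℝ) 1 := ⟨lt_of_le_of_lt (hv01 x).1 hq1, hq2.le.trans ha.2⟩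
        have : (q : ℝ) ≤ v x := h1 q hq0 (hx ⟨q, hq0, hq2⟩)
        linarith
    obtain ⟨q, hq1, hq2⟩ := exists_rat_btwn ha.1
    have hq0 : (q : ℝ) ∈ Ioc (0:ℝ) 1 := ⟨hq1, hq2.le.trans ha.2⟩
    refine (L q).isCompact.of_isClosed_subset ?_ (h2 q hq0 a hq2)
    rw [heq]
    exact isClosed_iInter fun q => (L q).isCompact.isClosed
  refine ⟨v, hv01, ?_, ?_, hc, h1, h2⟩
  · obtain ⟨x, hx⟩ := (L 1).nonempty
    have : ((1 : ℚ) : ℝ) ≤ v x := h1 1 (by simp) hx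
    exact ⟨x, le_antisymm (hv01 x).2 (by simpa using this)⟩
  · rw [upperSemicontinuous_iff_isClosed_preimage]
    intro a
    by_cases ha0 : a ≤ 0
    · have : v ⁻¹' Ici a = univ := eq_univ_of_forall fun x => ha0.trans (hv01 x).1
      rw [this]; exact isClosed_univ
    · by_cases ha1 : a ≤ 1
      · exact (hc a ⟨not_le.1 ha0, ha1⟩).isClosed
      · have : v ⁻¹' Ici a = ∅ := eq_empty_of_forall_notMem fun x hx =>
          ha1 (le_trans hx (hv01 x).2)
        rw [this]; exact isClosed_empty

open TopologicalSpace in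
theorem right_cont {m : ℕ} {v : Em m → ℝ} (hv : ∀ x, v x ∈ Icc (0:ℝ) 1)
    (hc : ∀ a ∈ Ioc (0:ℝ) 1, IsCompact (acut v a)) :
    ∃ E : Set ℝ, E.Countable ∧ ∀ a ∈ Ioc (0:ℝ) 1, a ∉ E → ∀ ε > (0:ℝ),
      ∃ r ∈ Ioc a 1, acut v a ⊆ thickening ε (acut v r) := by
  obtain ⟨b, hbc, -, hb⟩ := exists_countable_basis (Em m)
  refine ⟨insert 1 ((fun B => sSup (v '' B)) '' b), (hbc.image _).insert 1, ?_⟩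
  intro a ha haE ε hε
  have ha1 : a < 1 := lt_of_le_of_ne ha.2 fun h => haE (h ▸ mem_insert _ _)
  have : Nonempty (Ioc a 1) := ⟨⟨1, ha1, le_rfl⟩⟩
  suffices H : ∃ i : Ioc a 1, acut v a ⊆ thickening ε (acut v i) by
    obtain ⟨⟨r, hr⟩, hr'⟩ := H
    exact ⟨r, hr, hr'⟩
  refine (hc a ha).elim_directed_cover (fun i : Ioc a 1 => thickening ε (acut v i))
    (fun _ => isOpen_thickening) ?_ ?_
  · intro x hx
    obtain ⟨B, hB, hxB, hBx⟩ := hb.exists_subset_of_mem_open (mem_ball_self hε (x := x))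
      isOpen_ball
    have : ∃ y ∈ B, a < v y := by
      by_contra! hcon
      apply haE
      right
      refine ⟨B, hB, ?_⟩
      apply le_antisymm
      · apply csSup_le ⟨_, mem_image_of_mem v hxB⟩
        rintro _ ⟨y, hy, rfl⟩
        exact hcon y hy
      · refine le_trans (show a ≤ v x from hx) (le_csSup ⟨1, ?_⟩ (mem_image_of_mem v hxB))
        rintro _ ⟨y, hy, rfl⟩
        exact (hv y).2
    obtain ⟨y, hy, hay⟩ := this
    rw [mem_iUnion]
    refine ⟨⟨v y, hay, (hv y).2⟩, mem_thickening_iff.2 ⟨y, show v y ≤ v y from le_rfl, ?_⟩⟩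
    rw [dist_comm]
    exact hBx hy
  · intro i j
    refine ⟨min i j, ?_, ?_⟩
    · apply thickening_subset_of_subset
      intro z hz
      exact le_trans (Subtype.coe_le_coe.2 (min_le_left i j)) (show (i : ℝ) ≤ v z from hz)
    · apply thickening_subset_of_subset
      intro z hz
      exact le_trans (Subtype.coe_le_coe.2 (min_le_right i j)) (show (j : ℝ) ≤ v z from hz)

open TopologicalSpace in
theorem pt_conv {m : ℕ} {p : ℝ} {f : ℕ → Em m → ℝ} (hf : ∀ n, IsFuzzyBp p (f n))
    {L : ℚ → NonemptyCompacts (Em m)}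
    (hL : ∀ q : ℚ, (q : ℝ) ∈ Ioc (0:ℝ) 1 →
        Tendsto (fun n => hausdorffDist (acut (f n) q) (L q : Set (Em m))) atTop (nhds 0))
    {v : Em m → ℝ}
    (hc : ∀ a ∈ Ioc (0:ℝ) 1, IsCompact (acut v a))
    (h1 : ∀ q : ℚ, (q : ℝ) ∈ Ioc (0:ℝ) 1 → (L q : Set (Em m)) ⊆ acut v q)
    (h2 : ∀ q : ℚ, (q : ℝ) ∈ Ioc (0:ℝ) 1 → ∀ a : ℝ, q < a → acut v a ⊆ L q)
    {a : ℝ} (ha : a ∈ Ioc (0:ℝ) 1)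
    (hr : ∀ ε > (0:ℝ), ∃ r ∈ Ioc a 1, acut v a ⊆ thickening ε (acut v r)) :
    Tendsto (fun n => hausdorffDist (acut (f n) a) (acut v a)) atTop (nhds 0) := by
  rw [Metric.tendsto_atTop]
  intro ε hε
  have hε4 : 0 < ε / 4 := by linarith
  obtain ⟨b, hb, hbs⟩ := left_cont hc ha hε4
  obtain ⟨c, hc', hcs⟩ := hr (ε / 4) hε4
  obtain ⟨q, hq1, hq2⟩ := exists_rat_btwn hb.2
  obtain ⟨r, hr1, hr2⟩ := exists_rat_btwn hc'.1
  have hq : (q : ℝ) ∈ Ioc (0:ℝ) 1 := ⟨hb.1.trans hq1, hq2.le.trans ha.2⟩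
  have hr : (r : ℝ) ∈ Ioc (0:ℝ) 1 := ⟨ha.1.trans hr1, hr2.le.trans hc'.2⟩
  obtain ⟨N, hN⟩ := eventually_atTop.1 (((hL q hq).eventually (gt_mem_nhds hε4)).and
    ((hL r hr).eventually (gt_mem_nhds hε4)))
  refine ⟨N, fun n hn => ?_⟩
  obtain ⟨hn1, hn2⟩ := hN n hn
  rw [Real.dist_eq, sub_zero, abs_of_nonneg hausdorffDist_nonneg]
  refine lt_of_le_of_lt ?_ (half_lt_self hε)
  apply hausdorffDist_le_of_mem_dist (half_pos hε).le
  · intro x hx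
    have hx' : x ∈ acut (f n) q := (hf n).fam.anti _ hq _ ha hq2.le hx
    obtain ⟨y, hy, hxy⟩ := exists_dist_lt_of_hausdorffDist_lt hx' hn1
      (hed_ne_top ((hf n).fam.ne _ hq) ((hf n).fam.cpt _ hq) (L q).nonempty (L q).isCompact)
    have hy' : y ∈ acut v b := le_trans hq1.le (show (q : ℝ) ≤ v y from h1 q hq hy)
    obtain ⟨z, hz, hyz⟩ := mem_thickening_iff.1 (hbs hy')
    exact ⟨z, hz, by linarith [dist_triangle x y z]⟩
  · intro x hx
    obtain ⟨y, hy, hxy⟩ := mem_thickening_iff.1 (hcs hx)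
    obtain ⟨z, hz, hyz⟩ := exists_dist_lt_of_hausdorffDist_lt' (h2 r hr c hr2 hy) hn2
      (hed_ne_top ((hf n).fam.ne _ hr) ((hf n).fam.cpt _ hr) (L r).nonempty (L r).isCompact)
    rw [dist_comm] at hyz
    exact ⟨z, (hf n).fam.anti _ ha _ hr hr1.le hz, by linarith [dist_triangle x y z]⟩

theorem bdd_to_seq {m : ℕ} {p : ℝ} (hp : 1 ≤ p) {U : Set (Em m → ℝ)}
    (hU : ∀ u ∈ U, IsFuzzyBp p u) (hB : UPMB p U) (hLC : PMELC p U)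
    (f : ℕ → (Em m → ℝ)) (hf : ∀ n, f n ∈ U) :
    ∃ (φ : ℕ → ℕ) (v : Em m → ℝ), StrictMono φ ∧ IsFuzzyBp p v ∧
      Tendsto (fun n => dp p (f (φ n)) v) atTop (nhds 0) := by
  obtain ⟨φ, L, hφ, hL⟩ := extract hp hU hB hf
  have hg : ∀ n, IsFuzzyBp p (f (φ n)) := fun n => hU _ (hf _)
  obtain ⟨v, hv01, hv1, hvu, hvc, h1, h2⟩ := limit_exists
    (fun q r hq hr hqr => limit_anti (f := fun n => f (φ n)) hg hL hq hr hqr)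
  obtain ⟨E, hE, hEr⟩ := right_cont hv01 hvc
  have hvfam : Fam (acut v) (Ioc 0 1) := by
    refine ⟨fun a _ b _ hab x hx => le_trans hab hx, fun a ha => ?_, hvc⟩
    obtain ⟨x, hx⟩ := hv1
    exact ⟨x, show a ≤ v x by rw [hx]; exact ha.2⟩
  have hae : ∀ᵐ a ∂(volume.restrict (Ioc (0:ℝ) 1)),
      Tendsto (fun n => hausdorffDist (acut (f (φ n)) a) (acut v a)) atTop (nhds 0) := by
    filter_upwards [ae_restrict_mem measurableSet_Ioc, ae_restrict_of_ae (hE.ae_notMem volume)]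
      with a ha haE
    exact pt_conv (f := fun n => f (φ n)) hg hL hvc h1 h2 ha (hEr a ha haE)
  have hae0 : ∀ᵐ a ∂(volume.restrict (Ioc (0:ℝ) 1)),
      Tendsto (fun n => hausdorffDist (acut (f (φ n)) a) (zf m a)) atTop
        (nhds (hausdorffDist (acut v a) (zf m a))) := by
    filter_upwards [ae_restrict_mem measurableSet_Ioc, hae] with a ha hlim
    rw [tendsto_iff_dist_tendsto_zero]
    refine squeeze_zero (fun _ => dist_nonneg) (fun n => ?_) hlim
    have t1 := hausdorffDist_triangle (u := zf m a) ((hg n).fam.fin hvfam ha)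
    have t2 := hausdorffDist_triangle (u := zf m a) (hvfam.fin (hg n).fam ha)
    rw [hausdorffDist_comm (s := acut v a) (t := acut (f (φ n)) a)] at t2
    rw [Real.dist_eq, abs_le]
    constructor <;> linarith
  have fatou : ∀ η ∈ Ioc (0:ℝ) 1, ∀ c : ENNReal,
      (∀ u ∈ U, NH p (Ioc 0 η) (acut u) (zf m) ≤ c) → NH p (Ioc 0 η) (acut v) (zf m) ≤ c := by
    intro η hη c hc
    have hs : Ioc 0 η ⊆ Ioc (0:ℝ) 1 := Ioc_subset_Ioc_right hη.2
    refine le_trans (Lp.eLpNorm_lim_le_liminf_eLpNorm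
      (f := fun n a => hausdorffDist (acut (f (φ n)) a) (zf m a))
      (fun n => hd_aesm measurableSet_Ioc ((hg n).fam.subset hs) (zf_fam _)) _
      (ae_restrict_of_ae_restrict_of_subset hs hae0)) ?_
    refine le_trans (liminf_le_liminf (Eventually.of_forall fun n => hc _ (hf (φ n)))) ?_
    simp
  have hvB : IsFuzzyBp p v := by
    refine ⟨hv01, hv1, hvu, hvc, ?_⟩
    refine (integrable_iff hp (hd_aesm measurableSet_Ioc hvfam (zf_fam _))
      (fun _ => hausdorffDist_nonneg)).2 ?_
    obtain ⟨M, hM⟩ := hB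
    refine ne_top_of_le_ne_top ENNReal.ofReal_ne_top
      (fatou 1 ⟨one_pos, le_rfl⟩ (ENNReal.ofReal (max M 0)) fun u hu => ?_)
    rw [ENNReal.le_ofReal_iff_toReal_le (NH_zero_fin hp (hU u hu)) (le_max_right _ _),
      ← dpOrigin_eq hp (hU u hu)]
    exact (hM u hu).trans (le_max_left _ _)
  refine ⟨φ, v, hφ, hvB, ?_⟩
  rw [Metric.tendsto_atTop]
  intro ε hε
  have hε4 : 0 < ε / 4 := by linarith
  obtain ⟨η, hη, hηU⟩ := unif_tail hp hU hB hLC hε4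
  have hηv := fatou η hη _ hηU
  have hs : Ioc 0 η ⊆ Ioc (0:ℝ) 1 := Ioc_subset_Ioc_right hη.2
  have hs' : Ioc η 1 ⊆ Ioc (0:ℝ) 1 := Ioc_subset_Ioc_left hη.1.le
  obtain ⟨R, hR, hRU⟩ := cut_bound hp hU hB hη
  have hcore : Tendsto (fun n => NH p (Ioc η 1) (acut (f (φ n))) (acut v)) atTop (nhds 0) := by
    apply dct hp (C := R + hausdorffDist (acut v η) {0})
    · intro n
      exact hd_aesm measurableSet_Ioc ((hg n).fam.subset hs') (hvfam.subset hs')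
    · intro n
      filter_upwards [ae_restrict_mem measurableSet_Ioc] with a ha
      rw [Real.norm_of_nonneg hausdorffDist_nonneg]
      refine le_trans (hd_le_of_zero ((hg n).fam.ne a (hs' ha)) ((hg n).fam.cpt a (hs' ha))) ?_
      gcongr
      · exact (hd_zero_anti (hg n).fam hη (hs' ha) ha.1.le).trans (hRU _ (hf _))
      · exact hd_zero_anti hvfam hη (hs' ha) ha.1.le
    · exact ae_restrict_of_ae_restrict_of_subset hs' hae
  obtain ⟨N, hN⟩ := eventually_atTop.1 (hcore.eventually (gt_mem_nhds
    (show (0:ENNReal) < ENNReal.ofReal (ε / 4) by simpa using hε4)))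
  refine ⟨N, fun n hn => ?_⟩
  have hdp0 : 0 ≤ dp p (f (φ n)) v := by
    rw [dp_eq hp (hg n) hvB]; exact ENNReal.toReal_nonneg
  rw [Real.dist_eq, sub_zero, abs_of_nonneg hdp0, dp_lt_iff hp (hg n) hvB]
  have hu1 := NH_union hp (A := acut (f (φ n))) (B := acut v)
    (I := Ioc 0 η) (J := Ioc η 1) (K := Ioc 0 1) measurableSet_Ioc measurableSet_Ioc
    measurableSet_Ioc (by rw [Ioc_union_Ioc_eq_Ioc hη.1.le hη.2]) hs hs' (hg n).fam hvfam
  have htri := NH_tri hp measurableSet_Ioc ((hg n).fam.subset hs) (zf_fam _) (hvfam.subset hs)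
  rw [NH_comm p (Ioc 0 η) (zf m)] at htri
  calc _ ≤ _ := hu1
    _ ≤ ENNReal.ofReal (ε / 4) + ENNReal.ofReal (ε / 4) + ENNReal.ofReal (ε / 4) := by
        refine add_le_add (htri.trans (add_le_add (hηU _ (hf _)) hηv)) (hN n hn).le
    _ < ENNReal.ofReal ε := by
        rw [← ENNReal.ofReal_add (by positivity) (by positivity),
          ← ENNReal.ofReal_add (by positivity) (by positivity),
          ENNReal.ofReal_lt_ofReal_iff hε]
        linarith

/-- Characterization of totally bounded subsets of
`(F_B(ℝ^m)^p, d_p)`, and the equivalence of total boundedness with relative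
compactness in this space. -/
theorem totally_bounded_iff {m : ℕ} (p : ℝ) (hp : 1 ≤ p)
    (U : Set (Em m → ℝ)) (hU : ∀ u ∈ U, IsFuzzyBp p u) :
    ((∀ ε > (0:ℝ), ∃ S : Finset (Em m → ℝ), ↑S ⊆ U ∧ ∀ u ∈ U, ∃ v ∈ S, dp p u v < ε)
        ↔ (UPMB p U ∧ PMELC p U)) ∧
    ((∀ ε > (0:ℝ), ∃ S : Finset (Em m → ℝ), ↑S ⊆ U ∧ ∀ u ∈ U, ∃ v ∈ S, dp p u v < ε)
        ↔ (∀ f : ℕ → (Em m → ℝ), (∀ n, f n ∈ U) →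
            ∃ (φ : ℕ → ℕ) (v : Em m → ℝ), StrictMono φ ∧ IsFuzzyBp p v ∧
              Tendsto (fun n => dp p (f (φ n)) v) atTop (nhds 0))) := by
  have AB := tb_to_bdd hp hU
  have BC := fun h : UPMB p U ∧ PMELC p U => bdd_to_seq hp hU h.1 h.2
  have CA := seq_to_tb hp hU
  exact ⟨⟨AB, fun h => CA (BC h)⟩, ⟨fun h => BC (AB h), CA⟩⟩

end
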